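/- arXiv:2412.14604 — 9 statements merged into one kernel-verified Lean document; each statement's English description precedes it below -/
import Mathlib

section
/- Let α, t, n be real numbers with t > 0, and let v : ℝ → ℝ be twice differentiable on (0, ∞) satisfying v''(z) + (−2z + 2t/z³ + α/z)·v'(z) + (2n + α)·v(z) = 0 for all z > 0. Define u(x) := v(2^{−1/4}·t^{1/2}·x^{1/2}). Then for all x > 0, u is twice differentiable at x and u''(x) + (√2/x² + (1 + α)/(2x) − √2·t/2)·u'(x) + (√2·t·(2n + α)/(8x))·u(x) = 0 (a double-confluent Heun equation). -/
/-- The derivative of `x ↦ f (c √x)` at `x > 0`. -/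
theorem hasDerivAt_comp_const_mul_sqrt {f : ℝ → ℝ} {c x f' : ℝ} (hx : 0 < x)
    (hf : HasDerivAt f f' (c * Real.sqrt x)) :
    HasDerivAt (fun y => f (c * Real.sqrt y)) (f' * (c / (2 * Real.sqrt x))) x := by
  have h := hf.comp x ((Real.hasDerivAt_sqrt hx.ne').const_mul c)
  rwa [mul_one_div] at h

theorem sq_two_rpow_neg_quarter_mul_sqrt {t : ℝ} (ht : 0 ≤ t) :
    ((2 : ℝ) ^ (-(1 : ℝ) / 4) * Real.sqrt t) ^ 2 = Real.sqrt 2 * t / 2 := by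
  have h2 : ((2 : ℝ) ^ (-(1 : ℝ) / 4)) ^ 2 = Real.sqrt 2 / 2 := by
    rw [← Real.rpow_natCast, ← Real.rpow_mul zero_le_two, Real.sqrt_eq_rpow,
      ← Real.rpow_sub_one two_ne_zero]
    norm_num
  rw [mul_pow, h2, Real.sq_sqrt ht]
  ring


/-- The second-order ODE satisfied (in the large-`n` limit) by polynomials
orthogonal with respect to the singularly perturbed Gaussian weight
`w_SPG(x; t, α) = |x|^α exp(−x² − t/x²)` transforms, under the change of variable
`u(x) := v(2^{−1/4} t^{1/2} x^{1/2})`, into the double-confluent Heun equation. -/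
theorem spg_ode_to_double_confluent_heun
    (α t n : ℝ) (ht : 0 < t) (v : ℝ → ℝ)
    (hv : ∀ z ∈ Set.Ioi (0 : ℝ), DifferentiableAt ℝ v z)
    (hv' : ∀ z ∈ Set.Ioi (0 : ℝ), DifferentiableAt ℝ (deriv v) z)
    (hode : ∀ z ∈ Set.Ioi (0 : ℝ),
      deriv (deriv v) z + (-2 * z + 2 * t / z ^ 3 + α / z) * deriv v z
        + (2 * n + α) * v z = 0)
    (u : ℝ → ℝ)
    (hu : u = fun x => v ((2 : ℝ) ^ (-(1 : ℝ) / 4) * Real.sqrt t * Real.sqrt x)) :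
    ∀ x ∈ Set.Ioi (0 : ℝ),
      DifferentiableAt ℝ u x ∧ DifferentiableAt ℝ (deriv u) x ∧
      deriv (deriv u) x
        + (Real.sqrt 2 / x ^ 2 + (1 + α) / (2 * x) - Real.sqrt 2 * t / 2) * deriv u x
        + (Real.sqrt 2 * t * (2 * n + α) / (8 * x)) * u x = 0 := by
  have hc : 0 < (2 : ℝ) ^ (-(1 : ℝ) / 4) * Real.sqrt t := by positivity
  have hc2 := sq_two_rpow_neg_quarter_mul_sqrt ht.le
  generalize (2 : ℝ) ^ (-(1 : ℝ) / 4) * Real.sqrt t = c at hu hc hc2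
  subst hu
  have hz : ∀ x : ℝ, 0 < x → c * Real.sqrt x ∈ Set.Ioi (0 : ℝ) := fun x hx =>
    mul_pos hc (Real.sqrt_pos.2 hx)
  have hd1 : ∀ x : ℝ, 0 < x → HasDerivAt (fun y => v (c * Real.sqrt y))
      (deriv v (c * Real.sqrt x) * (c / (2 * Real.sqrt x))) x := fun x hx =>
    hasDerivAt_comp_const_mul_sqrt hx (hv _ (hz x hx)).hasDerivAt
  intro x hx
  replace hx : 0 < x := hx
  have hs : 0 < Real.sqrt x := Real.sqrt_pos.2 hx
  have hfactor : HasDerivAt (fun y => c / (2 * Real.sqrt y))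
      (-(c / (4 * Real.sqrt x ^ 3))) x := by
    have h := (hasDerivAt_const x c).div ((Real.hasDerivAt_sqrt hx.ne').const_mul 2)
      (by positivity)
    refine h.congr_deriv ?_
    field_simp
    ring
  have hd2 := ((hasDerivAt_comp_const_mul_sqrt hx (hv' _ (hz x hx)).hasDerivAt).mul
    hfactor).congr_of_eventuallyEq
      (f₁ := deriv fun y => v (c * Real.sqrt y))
      (by filter_upwards [Ioi_mem_nhds hx] with y hy using (hd1 y hy).deriv)
  refine ⟨(hd1 x hx).differentiableAt, hd2.differentiableAt, ?_⟩
  rw [hd2.deriv, (hd1 x hx).deriv]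
  beta_reduce
  have hode' := hode _ (hz x hx)
  have hxs : x = Real.sqrt x ^ 2 := (Real.sq_sqrt hx.le).symm
  have h2 : Real.sqrt 2 ^ 2 = 2 := Real.sq_sqrt zero_le_two
  have ht' : t = Real.sqrt 2 * c ^ 2 := by rw [hc2]; linear_combination (-t / 2) * h2
  generalize Real.sqrt x = s at *
  generalize Real.sqrt 2 = r at *
  subst hxs ht'
  generalize deriv (deriv v) (c * s) = v₂ at *
  generalize deriv v (c * s) = v₁ at *
  generalize v (c * s) = v₀ at *
  have hode_eq : v₂ = (2 * (c * s) - 2 * (r * c ^ 2) / (c * s) ^ 3 - α / (c * s)) * v₁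
      - (2 * n + α) * v₀ := by linear_combination hode'
  rw [hode_eq]
  field_simp
  ring_nf
  simp only [h2]
  ring
end

section
/- Let α, n be real numbers and let I ⊆ (0, ∞) be an open interval. Let λ, μ : I → ℝ with λ twice differentiable on I, μ differentiable on I, and λ(t) ≠ 0 for all t ∈ I. Suppose that for all t ∈ I the Hamilton equations λ'(t) = (1/t)·(2λ(t)²μ(t) + √2 + ((1 + α)/2)·λ(t) − (√2·t/2)·λ(t)² − 2λ(t)) and μ'(t) = −(1/t)·(2λ(t)μ(t)² + ((1 + α)/2 − √2·t·λ(t) − 2)·μ(t) + √2·t·(2n + α)/8) hold. Then for all t ∈ I, λ''(t) = λ'(t)²/λ(t) − λ'(t)/t + (√2(1 − 2n − 2α)/(4t))·λ(t)² + λ(t)³/2 + √2(3 − α)/(2t²) − 2/(λ(t)·t²). -/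
/-- Eliminating the momentum `μ` from the Hamiltonian system associated with
the isomonodromic deformation of the double-confluent Heun equation (singularly perturbed
Gaussian weight) yields a second-order ODE for `λ`. -/
theorem spg_hamilton_to_second_order_ode
    (α n : ℝ) (I : Set ℝ) (hI : ∃ a b : ℝ, I = Set.Ioo a b) (hIpos : I ⊆ Set.Ioi 0)
    (lam mu : ℝ → ℝ)
    (hlam : ∀ t ∈ I, DifferentiableAt ℝ lam t)
    (hlam' : ∀ t ∈ I, DifferentiableAt ℝ (deriv lam) t)
    (hmu : ∀ t ∈ I, DifferentiableAt ℝ mu t)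
    (hlam0 : ∀ t ∈ I, lam t ≠ 0)
    (hH1 : ∀ t ∈ I, deriv lam t
      = (1 / t) * (2 * (lam t) ^ 2 * mu t + Real.sqrt 2 + ((1 + α) / 2) * lam t
          - (Real.sqrt 2 * t / 2) * (lam t) ^ 2 - 2 * lam t))
    (hH2 : ∀ t ∈ I, deriv mu t
      = -(1 / t) * (2 * lam t * (mu t) ^ 2
          + ((1 + α) / 2 - Real.sqrt 2 * t * lam t - 2) * mu t
          + Real.sqrt 2 * t * (2 * n + α) / 8)) :
    ∀ t ∈ I, deriv (deriv lam) t
      = (deriv lam t) ^ 2 / lam t - deriv lam t / t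
        + (Real.sqrt 2 * (1 - 2 * n - 2 * α) / (4 * t)) * (lam t) ^ 2
        + (lam t) ^ 3 / 2
        + Real.sqrt 2 * (3 - α) / (2 * t ^ 2)
        - 2 / (lam t * t ^ 2) := by
  intro t ht
  have ht0 : t ≠ 0 := (hIpos ht).ne'
  have hl0 : lam t ≠ 0 := hlam0 t ht
  have hI_nhds : I ∈ nhds t := by
    obtain ⟨a, b, rfl⟩ := hI
    exact isOpen_Ioo.mem_nhds ht
  have hL := (hlam t ht).hasDerivAt
  have hM := (hmu t ht).hasDerivAt
  have hLHS : HasDerivAt (fun x => x * deriv lam x)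
      (1 * deriv lam t + t * deriv (deriv lam) t) t :=
    (hasDerivAt_id t).mul (hlam' t ht).hasDerivAt
  have hRHS : HasDerivAt (fun x => 2 * (lam x) ^ 2 * mu x + Real.sqrt 2
        + ((1 + α) / 2) * lam x - (Real.sqrt 2 * x / 2) * (lam x) ^ 2 - 2 * lam x) _ t :=
    ((((((hL.pow 2).const_mul 2).mul hM).add_const (Real.sqrt 2)).add
      (hL.const_mul ((1 + α) / 2))).sub
      ((((hasDerivAt_id t).const_mul (Real.sqrt 2)).div_const 2).mul (hL.pow 2))).sub
      (hL.const_mul 2)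
  have hEq : (fun x => x * deriv lam x) =ᶠ[nhds t] fun x => 2 * (lam x) ^ 2 * mu x
      + Real.sqrt 2 + ((1 + α) / 2) * lam x - (Real.sqrt 2 * x / 2) * (lam x) ^ 2
      - 2 * lam x := by
    filter_upwards [hI_nhds] with x hx
    have hx0 : x ≠ 0 := (hIpos hx).ne'
    rw [hH1 x hx]
    field_simp
  have hSecond := hLHS.unique (hRHS.congr_of_eventuallyEq hEq)
  simp only [Nat.cast_ofNat, Nat.add_one_sub_one, pow_one, id_eq, mul_one, one_mul,
    Pi.pow_apply] at hSecond
  have hMom : mu t = (t * deriv lam t - Real.sqrt 2 - ((1 + α) / 2) * lam t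
      + (Real.sqrt 2 * t / 2) * (lam t) ^ 2 + 2 * lam t) / (2 * (lam t) ^ 2) := by
    have h := hH1 t ht
    field_simp at h ⊢
    linear_combination -h
  have hsq : Real.sqrt 2 ^ 2 = 2 := Real.sq_sqrt (by norm_num)
  rw [hH2 t ht, hMom] at hSecond
  generalize deriv (deriv lam) t = D₂ at *
  generalize deriv lam t = D₁ at *
  generalize lam t = l at *
  generalize Real.sqrt 2 = s at *
  have hSolve : D₂ = ((D₁ + t * D₂) - D₁) / t := by field_simp; ring
  rw [hSolve, hSecond]
  field_simp
  linear_combination (32 * t ^ 2 * l ^ 4 - 128) * hsq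
end

section
/- Let α, n be real numbers and let I ⊆ (0, ∞) be an open interval. Let λ : I → ℝ be twice differentiable with λ(t) ≠ 0 for all t ∈ I, and suppose λ''(t) = λ'(t)²/λ(t) − λ'(t)/t + (√2(1 − 2n − 2α)/(4t))·λ(t)² + λ(t)³/2 + √2(3 − α)/(2t²) − 2/(λ(t)·t²) for all t ∈ I. Define y(t) := t·λ(t). Then for all t ∈ I, y''(t) = y'(t)²/y(t) − y'(t)/t + √2(1 − 2n − 2α)·y(t)²/(4t²) + y(t)³/(2t²) + √2(3 − α)/(2t) − 2/y(t); that is, y satisfies the Painlevé III′ equation with parameters (√2(1 − 2n − 2α), 2√2(3 − α), 2, −8). -/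
/-- The change of variable `y(t) := t·λ(t)` transforms the second-order ODE
for `λ` (obtained from the Hamiltonian system of the double-confluent Heun equation for the
singularly perturbed Gaussian weight) into the Painlevé III′ equation with parameters
`(√2(1 − 2n − 2α), 2√2(3 − α), 2, −8)`. -/
theorem spg_ode_to_painleve_III'
    (α n : ℝ) (I : Set ℝ) (hI : ∃ a b : ℝ, I = Set.Ioo a b) (hIpos : I ⊆ Set.Ioi 0)
    (lam : ℝ → ℝ)
    (hlam : ∀ t ∈ I, DifferentiableAt ℝ lam t)
    (hlam' : ∀ t ∈ I, DifferentiableAt ℝ (deriv lam) t)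
    (hlam0 : ∀ t ∈ I, lam t ≠ 0)
    (hode : ∀ t ∈ I, deriv (deriv lam) t
      = (deriv lam t) ^ 2 / lam t - deriv lam t / t
        + (Real.sqrt 2 * (1 - 2 * n - 2 * α) / (4 * t)) * (lam t) ^ 2
        + (lam t) ^ 3 / 2
        + Real.sqrt 2 * (3 - α) / (2 * t ^ 2)
        - 2 / (lam t * t ^ 2))
    (y : ℝ → ℝ) (hy : y = fun t => t * lam t) :
    ∀ t ∈ I, deriv (deriv y) t
      = (deriv y t) ^ 2 / y t - deriv y t / t
        + Real.sqrt 2 * (1 - 2 * n - 2 * α) * (y t) ^ 2 / (4 * t ^ 2)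
        + (y t) ^ 3 / (2 * t ^ 2)
        + Real.sqrt 2 * (3 - α) / (2 * t)
        - 2 / y t := by
  obtain ⟨a, b, rfl⟩ := hI
  have hderiv : ∀ t ∈ Set.Ioo a b, deriv y t = lam t + t * deriv lam t := by
    intro t ht
    have h : HasDerivAt (fun s => s * lam s) (1 * lam t + t * deriv lam t) t :=
      (hasDerivAt_id' t).mul (hlam t ht).hasDerivAt
    rw [hy, h.deriv, one_mul]
  intro t ht
  have hderiv2 : deriv (deriv y) t = 2 * deriv lam t + t * deriv (deriv lam) t := by
    have heq : deriv y =ᶠ[nhds t] (fun s => lam s + s * deriv lam s) :=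
      Filter.eventuallyEq_of_mem (isOpen_Ioo.mem_nhds ht) hderiv
    have h : HasDerivAt (fun s => lam s + s * deriv lam s)
        (deriv lam t + (1 * deriv lam t + t * deriv (deriv lam) t)) t :=
      (hlam t ht).hasDerivAt.add ((hasDerivAt_id' t).mul (hlam' t ht).hasDerivAt)
    rw [heq.deriv_eq, h.deriv]
    ring
  have ht0 : t ≠ 0 := ne_of_gt (hIpos ht)
  have hl0 := hlam0 t ht
  rw [hderiv2, hderiv t ht, hode t ht, hy]
  field_simp
  ring
end

section
/- Let α, t, n be real numbers and let v : ℝ → ℝ be twice differentiable on (0, ∞) satisfying v''(z) − (4z³ − 2t·z − (2α + 1)/z)·v'(z) + (4n/3)^{3/2}·v(z) = 0 for all z > 0. Define u(x) := v(2^{−1/4}·x^{1/2}). Then for all x > 0, u is twice differentiable at x and u''(x) + ((1 + α)/x + √2·t/2 − x)·u'(x) + (√6·n^{3/2}/(9x))·u(x) = 0 (a biconfluent Heun equation). -/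
theorem rpow_three_halves_of_neg {x : ℝ} (hx : x < 0) : x ^ ((3 : ℝ) / 2) = 0 := by
  have h : Real.cos ((3 : ℝ) / 2 * Real.pi) = 0 := by
    rw [Real.cos_eq_zero_iff]
    exact ⟨1, by push_cast; ring⟩
  rw [Real.rpow_def_of_neg hx, h, mul_zero]

theorem rpow_three_halves_of_nonneg {x : ℝ} (hx : 0 ≤ x) :
    x ^ ((3 : ℝ) / 2) = x * Real.sqrt x := by
  rw [show (3 : ℝ) / 2 = 1 + 1 / 2 by norm_num, Real.rpow_add_of_nonneg hx (by norm_num)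
    (by norm_num), Real.rpow_one, Real.sqrt_eq_rpow]

theorem four_mul_div_three_rpow_three_halves (n : ℝ) :
    (4 * n / 3) ^ ((3 : ℝ) / 2)
      = 4 * Real.sqrt 2 * Real.sqrt 6 / 9 * n ^ ((3 : ℝ) / 2) := by
  rcases lt_or_ge n 0 with hn | hn
  · rw [rpow_three_halves_of_neg hn, rpow_three_halves_of_neg (by linarith), mul_zero]
  · have h43 : Real.sqrt (4 / 3) = Real.sqrt 2 * Real.sqrt 6 / 3 := by
      rw [← Real.sqrt_mul (by norm_num), show (4 / 3 : ℝ) = 2 * 6 / 3 ^ 2 by norm_num,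
        Real.sqrt_div (by norm_num), Real.sqrt_sq (by norm_num)]
    rw [rpow_three_halves_of_nonneg hn, rpow_three_halves_of_nonneg (by positivity),
      show 4 * n / 3 = 4 / 3 * n by ring, Real.sqrt_mul (by norm_num), h43]
    ring

theorem two_rpow_neg_one_div_four_sq :
    ((2 : ℝ) ^ (-(1 : ℝ) / 4)) ^ 2 = Real.sqrt 2 / 2 := by
  rw [← Real.rpow_natCast, ← Real.rpow_mul (by norm_num), Real.sqrt_eq_rpow,
    show -(1 : ℝ) / 4 * ((2 : ℕ) : ℝ) = 1 / 2 - 1 by norm_num,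
    Real.rpow_sub_one (by norm_num)]


/-- The limiting second-order ODE for polynomials orthogonal with respect to
the deformed Freud weight `w_DF(x; α, t) = |x|^α exp(−x⁴ + t x²)` transforms, under the
change of variable `u(x) := v(2^{−1/4} x^{1/2})`, into a biconfluent Heun equation. -/
theorem freud_ode_to_biconfluent_heun
    (α t n : ℝ) (v : ℝ → ℝ)
    (hv : ∀ z ∈ Set.Ioi (0 : ℝ), DifferentiableAt ℝ v z)
    (hv' : ∀ z ∈ Set.Ioi (0 : ℝ), DifferentiableAt ℝ (deriv v) z)
    (hode : ∀ z ∈ Set.Ioi (0 : ℝ),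
      deriv (deriv v) z - (4 * z ^ 3 - 2 * t * z - (2 * α + 1) / z) * deriv v z
        + (4 * n / 3) ^ ((3 : ℝ) / 2) * v z = 0)
    (u : ℝ → ℝ)
    (hu : u = fun x => v ((2 : ℝ) ^ (-(1 : ℝ) / 4) * Real.sqrt x)) :
    ∀ x ∈ Set.Ioi (0 : ℝ),
      DifferentiableAt ℝ u x ∧ DifferentiableAt ℝ (deriv u) x ∧
      deriv (deriv u) x
        + ((1 + α) / x + Real.sqrt 2 * t / 2 - x) * deriv u x
        + (Real.sqrt 6 * n ^ ((3 : ℝ) / 2) / (9 * x)) * u x = 0 := by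
  set c : ℝ := (2 : ℝ) ^ (-(1 : ℝ) / 4) with hc
  have hc0 : 0 < c := by positivity
  have hc2 : c ^ 2 = Real.sqrt 2 / 2 := two_rpow_neg_one_div_four_sq
  have h2 : Real.sqrt 2 ^ 2 = 2 := Real.sq_sqrt (by norm_num)
  have hinner : ∀ y : ℝ, 0 < y →
      HasDerivAt (fun x => c * Real.sqrt x) (c * (1 / (2 * Real.sqrt y))) y := fun y hy =>
    (Real.hasDerivAt_sqrt hy.ne').const_mul c
  have hd : ∀ y : ℝ, 0 < y →
      HasDerivAt u (deriv v (c * Real.sqrt y) * (c * (1 / (2 * Real.sqrt y)))) y := by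
    intro y hy
    rw [hu]
    exact (hv _ (mul_pos hc0 (Real.sqrt_pos.2 hy))).hasDerivAt.comp y (hinner y hy)
  intro x hx
  have hx : 0 < x := hx
  have hs : 0 < Real.sqrt x := Real.sqrt_pos.2 hx
  have hsq : Real.sqrt x ^ 2 = x := Real.sq_sqrt hx.le
  have hz : 0 < c * Real.sqrt x := mul_pos hc0 hs
  have heq : deriv u =ᶠ[nhds x]
      fun y => deriv v (c * Real.sqrt y) * (c * (1 / (2 * Real.sqrt y))) := by
    filter_upwards [Ioi_mem_nhds hx] with y hy using (hd y hy).deriv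
  have houter : HasDerivAt (fun y => deriv v (c * Real.sqrt y))
      (deriv (deriv v) (c * Real.sqrt x) * (c * (1 / (2 * Real.sqrt x)))) x :=
    HasDerivAt.comp (h₂ := deriv v) x (hv' _ hz).hasDerivAt (hinner x hx)
  have hfactor : HasDerivAt (fun y => c * (1 / (2 * Real.sqrt y)))
      (-c / (4 * Real.sqrt x ^ 3)) x := by
    have h := ((((Real.hasDerivAt_sqrt hx.ne').const_mul 2).fun_inv (by positivity)).const_mul c)
    simp only [one_div]
    refine h.congr_deriv ?_
    field_simp
    norm_num
  have hdd := (houter.mul hfactor).congr_of_eventuallyEq heq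
  refine ⟨(hd x hx).differentiableAt, hdd.differentiableAt, ?_⟩
  have hux : u x = v (c * Real.sqrt x) := by rw [hu]
  have h := hode _ hz
  rw [four_mul_div_three_rpow_three_halves] at h
  rw [hdd.deriv, (hd x hx).deriv, hux]
  generalize deriv (deriv v) (c * Real.sqrt x) = v₂ at h ⊢
  generalize deriv v (c * Real.sqrt x) = v₁ at h ⊢
  generalize v (c * Real.sqrt x) = v₀ at h ⊢
  generalize n ^ ((3 : ℝ) / 2) = N at h ⊢
  generalize Real.sqrt 6 = r at h ⊢
  have hv₂ : v₂ = (4 * (c * Real.sqrt x) ^ 3 - 2 * t * (c * Real.sqrt x)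
      - (2 * α + 1) / (c * Real.sqrt x)) * v₁ - 4 * Real.sqrt 2 * r / 9 * N * v₀ := by
    linarith
  generalize Real.sqrt x = s at *
  generalize Real.sqrt 2 = w at *
  have hw : w = 2 * c ^ 2 := by linarith
  have hc4 : c ^ 4 = 1 / 2 := by rw [hw] at h2; linarith
  subst hw hsq
  rw [hv₂]
  field_simp
  linear_combination (144 * c * s ^ 4 * v₁ - 32 * s * r * N * v₀) * hc4
end

section
/- Let α be a real number and let I ⊆ ℝ be an open interval. Let λ, μ : I → ℝ with λ twice differentiable on I, μ differentiable on I, and λ(t) ≠ 0 for all t ∈ I. Suppose that for all t ∈ I the Hamilton equations λ'(t) = −√2·λ(t)·μ(t) − √2·α/2 − (t/2)·λ(t) + (√2/2)·λ(t)² and μ'(t) = (√2/2)·(μ(t)² + ((√2/2)·t − 2λ(t))·μ(t)) hold. Then for all t ∈ I, λ''(t) = λ'(t)²/(2λ(t)) + (3/4)·λ(t)³ − (√2/2)·t·λ(t)² + (t²/8)·λ(t) − ((α + 1)/2)·λ(t) − α²/(4λ(t)). -/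
/-- Eliminating the momentum `μ` from the Hamiltonian system associated with
the isomonodromic deformation of the biconfluent Heun equation (deformed Freud weight)
yields a second-order ODE for `λ`. -/
theorem freud_hamilton_to_second_order_ode
    (α : ℝ) (I : Set ℝ) (hI : ∃ a b : ℝ, I = Set.Ioo a b)
    (lam mu : ℝ → ℝ)
    (hlam : ∀ t ∈ I, DifferentiableAt ℝ lam t)
    (hlam' : ∀ t ∈ I, DifferentiableAt ℝ (deriv lam) t)
    (hmu : ∀ t ∈ I, DifferentiableAt ℝ mu t)
    (hlam0 : ∀ t ∈ I, lam t ≠ 0)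
    (hH1 : ∀ t ∈ I, deriv lam t
      = -Real.sqrt 2 * lam t * mu t - Real.sqrt 2 * α / 2 - (t / 2) * lam t
        + (Real.sqrt 2 / 2) * (lam t) ^ 2)
    (hH2 : ∀ t ∈ I, deriv mu t
      = (Real.sqrt 2 / 2) * ((mu t) ^ 2 + ((Real.sqrt 2 / 2) * t - 2 * lam t) * mu t)) :
    ∀ t ∈ I, deriv (deriv lam) t
      = (deriv lam t) ^ 2 / (2 * lam t) + (3 / 4) * (lam t) ^ 3
        - (Real.sqrt 2 / 2) * t * (lam t) ^ 2 + (t ^ 2 / 8) * lam t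
        - ((α + 1) / 2) * lam t - α ^ 2 / (4 * lam t) := by
  intro t ht
  have hI_open : IsOpen I := by
    obtain ⟨a, b, rfl⟩ := hI
    exact isOpen_Ioo
  have hL := (hlam t ht).hasDerivAt
  have hM := (hmu t ht).hasDerivAt
  have hd : HasDerivAt
      (fun x => -Real.sqrt 2 * lam x * mu x - Real.sqrt 2 * α / 2 - (x / 2) * lam x
        + (Real.sqrt 2 / 2) * (lam x) ^ 2) _ t :=
    ((((hL.const_mul (-Real.sqrt 2)).mul hM).sub_const (Real.sqrt 2 * α / 2)).sub
      (((hasDerivAt_id t).div_const 2).mul hL)).add ((hL.pow 2).const_mul (Real.sqrt 2 / 2))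
  have heq : deriv lam =ᶠ[nhds t] fun x =>
      -Real.sqrt 2 * lam x * mu x - Real.sqrt 2 * α / 2 - (x / 2) * lam x
        + (Real.sqrt 2 / 2) * (lam x) ^ 2 :=
    Filter.eventually_of_mem (hI_open.mem_nhds ht) hH1
  have hs : Real.sqrt 2 ^ 2 = 2 := Real.sq_sqrt zero_le_two
  have h0 := hlam0 t ht
  rw [heq.deriv_eq, hd.deriv, hH2 t ht, hH1 t ht]
  simp only [id]
  generalize Real.sqrt 2 = s at hs ⊢
  field_simp
  grind
end

section
/- Let I ⊆ ℝ be an open interval and let λ, μ : I → ℝ with λ twice differentiable on I, μ differentiable on I, and λ(t) ≠ 0 for all t ∈ I. Suppose that for all t ∈ I the Hamilton equations λ'(t) = 2√2·λ(t)·μ(t) − (2t·λ(t) + √2·λ(t)²) and μ'(t) = −√2·μ(t)² + (2t + 2√2·λ(t))·μ(t) hold. Then for all t ∈ I, λ''(t) = λ'(t)²/(2λ(t)) + 3λ(t)³ + 4√2·t·λ(t)² + 2t²·λ(t) − 2λ(t). -/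
/-- Eliminating the momentum `μ` from the Hamiltonian system associated with
the isomonodromic deformation of the biconfluent Heun equation (jumpy Gaussian weight)
yields a second-order ODE for `λ`. -/
theorem jumpy_gaussian_hamilton_to_second_order_ode
    (I : Set ℝ) (hI : ∃ a b : ℝ, I = Set.Ioo a b)
    (lam mu : ℝ → ℝ)
    (hlam : ∀ t ∈ I, DifferentiableAt ℝ lam t)
    (hlam' : ∀ t ∈ I, DifferentiableAt ℝ (deriv lam) t)
    (hmu : ∀ t ∈ I, DifferentiableAt ℝ mu t)
    (hlam0 : ∀ t ∈ I, lam t ≠ 0)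
    (hH1 : ∀ t ∈ I, deriv lam t
      = 2 * Real.sqrt 2 * lam t * mu t - (2 * t * lam t + Real.sqrt 2 * (lam t) ^ 2))
    (hH2 : ∀ t ∈ I, deriv mu t
      = -Real.sqrt 2 * (mu t) ^ 2 + (2 * t + 2 * Real.sqrt 2 * lam t) * mu t) :
    ∀ t ∈ I, deriv (deriv lam) t
      = (deriv lam t) ^ 2 / (2 * lam t) + 3 * (lam t) ^ 3
        + 4 * Real.sqrt 2 * t * (lam t) ^ 2 + 2 * t ^ 2 * lam t - 2 * lam t := by
  obtain ⟨a, b, rfl⟩ := hI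
  intro t ht
  have hl := (hlam t ht).hasDerivAt
  have hm := (hmu t ht).hasDerivAt
  have hderiv : HasDerivAt (deriv lam)
      (2 * Real.sqrt 2 * (deriv lam t * mu t + lam t * deriv mu t)
        - (2 * (1 * lam t + t * deriv lam t)
          + Real.sqrt 2 * (2 * lam t * deriv lam t))) t := by
    have h := ((hl.mul hm).const_mul (2 * Real.sqrt 2)).sub
      ((((hasDerivAt_id t).mul hl).const_mul 2).add ((hl.pow 2).const_mul (Real.sqrt 2)))
    refine (h.congr_of_eventuallyEq ?_).congr_deriv ?_
    · filter_upwards [Ioo_mem_nhds ht.1 ht.2] with x hx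
      rw [hH1 x hx]
      simp only [Pi.add_apply, Pi.sub_apply, Pi.mul_apply, Pi.pow_apply, id]
      ring
    · simp
  have hsq : (deriv lam t) ^ 2 / (2 * lam t)
      = lam t * (2 * Real.sqrt 2 * mu t - 2 * t - Real.sqrt 2 * lam t) ^ 2 / 2 := by
    have h0 := hlam0 t ht
    rw [hH1 t ht]
    field_simp
    ring
  have h2 : Real.sqrt 2 ^ 2 = 2 := Real.sq_sqrt zero_le_two
  rw [hderiv.deriv, hsq, hH1 t ht, hH2 t ht]
  linear_combination (3 / 2 * lam t ^ 3) * h2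
end

section
/- Let α, n be real numbers, a ∈ (0, 1), and set t := a². Let v : ℝ → ℝ be twice differentiable on (a, 1) satisfying v''(z) + (2z/(z² − a²) + 2(α + 1)z/(z² − 1) − 2/z)·v'(z) − ((n·a + z²·(2α + n + 1)·n)/((z² − 1)(z² − a²)))·v(z) = 0 for all z ∈ (a, 1). Define u(x) := v(√x). Then for all x ∈ (t, 1), u is twice differentiable at x and u''(x) + (−1/(2x) + (1 + α)/(x − 1) + 1/(x − t))·u'(x) − ((n(n + 2α + 1)·x + n·√t)/(4x(x − 1)(x − t)))·u(x) = 0 (a general Heun equation with regular singular points 0, 1, t, ∞). -/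
theorem hasDerivAt_comp_sqrt {f : ℝ → ℝ} {f' x : ℝ} (hx : 0 < x)
    (hf : HasDerivAt f f' √x) : HasDerivAt (fun y => f √y) (f' / (2 * √x)) x := by
  rw [← mul_one_div]
  exact hf.comp x (Real.hasDerivAt_sqrt hx.ne')

/-- The limiting second-order ODE for polynomials orthogonal with respect to
the Jacobi-type weight `w_JC(x; α, a) = (1 − x²)^α (1 − χ_{(−a,a)}(x))` transforms, under the
changes of variable `u(x) := v(√x)` and `t = a²`, into a general Heun equation with regular
singular points `0, 1, t, ∞`. -/
theorem jacobi_ode_to_general_heun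
    (α n a : ℝ) (ha : a ∈ Set.Ioo (0 : ℝ) 1) (t : ℝ) (ht : t = a ^ 2)
    (v : ℝ → ℝ)
    (hv : ∀ z ∈ Set.Ioo a 1, DifferentiableAt ℝ v z)
    (hv' : ∀ z ∈ Set.Ioo a 1, DifferentiableAt ℝ (deriv v) z)
    (hode : ∀ z ∈ Set.Ioo a 1,
      deriv (deriv v) z
        + (2 * z / (z ^ 2 - a ^ 2) + 2 * (α + 1) * z / (z ^ 2 - 1) - 2 / z) * deriv v z
        - ((n * a + z ^ 2 * (2 * α + n + 1) * n) / ((z ^ 2 - 1) * (z ^ 2 - a ^ 2))) * v z = 0)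
    (u : ℝ → ℝ) (hu : u = fun x => v (Real.sqrt x)) :
    ∀ x ∈ Set.Ioo t 1,
      DifferentiableAt ℝ u x ∧ DifferentiableAt ℝ (deriv u) x ∧
      deriv (deriv u) x
        + (-(1 / (2 * x)) + (1 + α) / (x - 1) + 1 / (x - t)) * deriv u x
        - ((n * (n + 2 * α + 1) * x + n * Real.sqrt t) / (4 * x * (x - 1) * (x - t))) * u x
          = 0 := by
  intro x hx
  obtain ⟨ha0, -⟩ := ha
  subst ht hu
  have sqrt_mem : ∀ y ∈ Set.Ioo (a ^ 2) 1, √y ∈ Set.Ioo a 1 := fun y hy =>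
    ⟨Real.lt_sqrt_of_sq_lt hy.1, (Real.sqrt_lt' one_pos).2 (by simpa using hy.2)⟩
  have pos : ∀ y ∈ Set.Ioo (a ^ 2) 1, 0 < y := fun y hy => (sq_nonneg a).trans_lt hy.1
  have hu1 : ∀ y ∈ Set.Ioo (a ^ 2) 1,
      HasDerivAt (fun x => v √x) (deriv v √y / (2 * √y)) y := fun y hy =>
    hasDerivAt_comp_sqrt (pos y hy) (hv _ (sqrt_mem y hy)).hasDerivAt
  have hderiv : deriv (fun x => v √x) =ᶠ[nhds x] fun y => deriv v √y / (2 * √y) := by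
    filter_upwards [isOpen_Ioo.mem_nhds hx] with y hy using (hu1 y hy).deriv
  have hx0 := pos x hx
  have hs0 : 0 < √x := Real.sqrt_pos.2 hx0
  have hu2 := ((hasDerivAt_comp_sqrt hx0 (hv' _ (sqrt_mem x hx)).hasDerivAt).div
    ((Real.hasDerivAt_sqrt hx0.ne').const_mul 2) (by positivity)).congr_of_eventuallyEq hderiv
  refine ⟨(hu1 x hx).differentiableAt, hu2.differentiableAt, ?_⟩
  have hode_x := hode _ (sqrt_mem x hx)
  rw [hu2.deriv, (hu1 x hx).deriv, Real.sqrt_sq ha0.le]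
  beta_reduce
  have hsq : √x ^ 2 = x := Real.sq_sqrt hx0.le
  have h1 : √x ^ 2 - 1 ≠ 0 := by rw [hsq]; exact (sub_neg.2 hx.2).ne
  have ht : √x ^ 2 - a ^ 2 ≠ 0 := by rw [hsq]; exact (sub_pos.2 hx.1).ne'
  generalize √x = s at *
  subst hsq
  generalize deriv (deriv v) s = v₂ at *
  generalize deriv v s = v₁ at *
  generalize v s = v₀ at *
  have hv₂ := eq_sub_of_add_eq (sub_eq_zero.1 hode_x)
  rw [hv₂]
  field_simp
  ring
end

section
/- Let α, n be real numbers and let I ⊆ (0, 1) be an open interval. Let λ, μ : I → ℝ with λ twice differentiable on I, μ differentiable on I, and λ(t) ∉ {0, 1, t} for all t ∈ I. Suppose that for all t ∈ I the Hamilton equations λ'(t) = (2λ(λ − 1)(λ − t)·μ − (3/2)(λ − 1)(λ − t) + α·λ(λ − t) + λ(λ − 1))/(t(t − 1)) and μ'(t) = −(((λ − 1)(λ − t) + λ(λ − t) + λ(λ − 1))·μ² + (−(3/2)(2λ − 1 − t) + α(2λ − t) + 2λ − 1)·μ − n(n + 2α + 1)/4)/(t(t − 1)) hold (with λ = λ(t),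 μ = μ(t)). Then λ satisfies the Painlevé VI equation: for all t ∈ I, λ'' = (1/2)(1/λ + 1/(λ − 1) + 1/(λ − t))·(λ')² − (1/t + 1/(t − 1) + 1/(λ − t))·λ' + (λ(λ − 1)(λ − t)/(t²(t − 1)²))·(α̂ + β·t/λ² + γ·(t − 1)/(λ − 1)² + δ·t(t − 1)/(λ − t)²), where α̂ = n(n + 2α + 1)/2 + (2α − 1)²/8, β = −9/8, γ = α²/2, δ = 1/2. -/
/-- The algebraic elimination behind Painlevé VI: `x = λ`, `m = μ`, `p = λ'`, `q = μ'`, `r = λ''`,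
where `hr` is the first Hamilton equation (cleared of its denominator) differentiated in `t`. -/
theorem painleve_VI_of_hamilton_algebra {α n t x m p q r : ℝ}
    (ht0 : t ≠ 0) (ht1 : t - 1 ≠ 0) (hx0 : x ≠ 0) (hx1 : x - 1 ≠ 0) (hxt : x - t ≠ 0)
    (hp : p = (2 * x * (x - 1) * (x - t) * m
        - (3 / 2) * (x - 1) * (x - t) + α * x * (x - t) + x * (x - 1)) / (t * (t - 1)))
    (hq : q = -((((x - 1) * (x - t) + x * (x - t) + x * (x - 1)) * m ^ 2
          + (-(3 / 2) * (2 * x - 1 - t) + α * (2 * x - t) + 2 * x - 1) * m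
          - n * (n + 2 * α + 1) / 4) / (t * (t - 1))))
    (hr : (2 * t - 1) * p + t * (t - 1) * r
      = 2 * ((x - 1) * (x - t) + x * (x - t) + x * (x - 1)) * m * p
        + (-(3 / 2) * (2 * x - 1 - t) + α * (2 * x - t) + 2 * x - 1) * p
        - 2 * x * (x - 1) * m + (3 / 2) * (x - 1) - α * x
        + 2 * x * (x - 1) * (x - t) * q) :
    r = (1 / 2) * (1 / x + 1 / (x - 1) + 1 / (x - t)) * p ^ 2
        - (1 / t + 1 / (t - 1) + 1 / (x - t)) * p
        + (x * (x - 1) * (x - t) / (t ^ 2 * (t - 1) ^ 2))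
          * ((n * (n + 2 * α + 1) / 2 + (2 * α - 1) ^ 2 / 8)
            + (-(9 / 8)) * t / x ^ 2
            + (α ^ 2 / 2) * (t - 1) / (x - 1) ^ 2
            + (1 / 2) * t * (t - 1) / (x - t) ^ 2) := by
  have htt : t * (t - 1) ≠ 0 := mul_ne_zero ht0 ht1
  apply mul_left_cancel₀ htt
  rw [eq_sub_of_add_eq' hr, hq, hp]
  field_simp
  ring

/-- Eliminating the momentum `μ` from the Hamiltonian system associated with
the isomonodromic deformation of the general Heun equation (Jacobi-type weight) yields the
Painlevé VI equation for `λ`, with parameters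
`α̂ = n(n + 2α + 1)/2 + (2α − 1)²/8, β = −9/8, γ = α²/2, δ = 1/2`. -/
theorem jacobi_hamilton_to_painleve_VI
    (α n : ℝ) (I : Set ℝ) (hI : ∃ a b : ℝ, I = Set.Ioo a b)
    (hIsub : I ⊆ Set.Ioo (0 : ℝ) 1)
    (lam mu : ℝ → ℝ)
    (hlam : ∀ t ∈ I, DifferentiableAt ℝ lam t)
    (hlam' : ∀ t ∈ I, DifferentiableAt ℝ (deriv lam) t)
    (hmu : ∀ t ∈ I, DifferentiableAt ℝ mu t)
    (hlam0 : ∀ t ∈ I, lam t ≠ 0)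
    (hlam1 : ∀ t ∈ I, lam t ≠ 1)
    (hlamt : ∀ t ∈ I, lam t ≠ t)
    (hH1 : ∀ t ∈ I, deriv lam t
      = (2 * lam t * (lam t - 1) * (lam t - t) * mu t
          - (3 / 2) * (lam t - 1) * (lam t - t) + α * lam t * (lam t - t)
          + lam t * (lam t - 1)) / (t * (t - 1)))
    (hH2 : ∀ t ∈ I, deriv mu t
      = -((((lam t - 1) * (lam t - t) + lam t * (lam t - t) + lam t * (lam t - 1))
              * (mu t) ^ 2
            + (-(3 / 2) * (2 * lam t - 1 - t) + α * (2 * lam t - t) + 2 * lam t - 1)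
              * mu t
            - n * (n + 2 * α + 1) / 4) / (t * (t - 1)))) :
    ∀ t ∈ I, deriv (deriv lam) t
      = (1 / 2) * (1 / lam t + 1 / (lam t - 1) + 1 / (lam t - t)) * (deriv lam t) ^ 2
        - (1 / t + 1 / (t - 1) + 1 / (lam t - t)) * deriv lam t
        + (lam t * (lam t - 1) * (lam t - t) / (t ^ 2 * (t - 1) ^ 2))
          * ((n * (n + 2 * α + 1) / 2 + (2 * α - 1) ^ 2 / 8)
            + (-(9 / 8)) * t / (lam t) ^ 2
            + (α ^ 2 / 2) * (t - 1) / (lam t - 1) ^ 2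
            + (1 / 2) * t * (t - 1) / (lam t - t) ^ 2) := by
  intro t ht
  obtain ⟨a, b, rfl⟩ := hI
  have ht0 : t ≠ 0 := (hIsub ht).1.ne'
  have ht1 : t - 1 ≠ 0 := sub_ne_zero.2 (hIsub ht).2.ne
  refine painleve_VI_of_hamilton_algebra ht0 ht1 (hlam0 t ht) (sub_ne_zero.2 (hlam1 t ht))
    (sub_ne_zero.2 (hlamt t ht)) (hH1 t ht) (hH2 t ht) ?_
  have hid := hasDerivAt_id' t
  have hl := (hlam t ht).hasDerivAt
  have hm := (hmu t ht).hasDerivAt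
  have hl1 := hl.sub_const 1
  have hlt := hl.sub hid
  have hL := (hid.mul (hid.sub_const 1)).mul (hlam' t ht).hasDerivAt
  have hR := ((((((hl.const_mul 2).mul hl1).mul hlt).mul hm).sub
    ((hl1.const_mul (3 / 2)).mul hlt)).add ((hl.const_mul α).mul hlt)).add (hl.mul hl1)
  have heq := hL.unique (hR.congr_of_eventuallyEq ?_)
  · simp only [Pi.mul_apply, Pi.sub_apply] at heq
    linear_combination heq
  · filter_upwards [Ioo_mem_nhds ht.1 ht.2] with s hs
    have hs0 : s ≠ 0 := (hIsub hs).1.ne'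
    have hs1 : s - 1 ≠ 0 := sub_ne_zero.2 (hIsub hs).2.ne
    simp only [Pi.mul_apply, Pi.sub_apply, Pi.add_apply]
    rw [hH1 s hs]
    field_simp
end

section
/- Let c : ℕ → ℝ be a sequence with c_{2k+1} = 0 for all k ∈ ℕ. Then for every n ∈ ℕ: (i) det((c_{i+j})_{i,j=0}^{2n−1}) = det((c_{2(i+j)})_{i,j=0}^{n−1}) · det((c_{2(i+j)+2})_{i,j=0}^{n−1}), and (ii) det((c_{i+j})_{i,j=0}^{2n}) = det((c_{2(i+j)})_{i,j=0}^{n}) · det((c_{2(i+j)+2})_{i,j=0}^{n−1}). -/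
/-- The Hankel determinant of order `p + q`, with `q ≤ p ≤ q + 1`, of a sequence whose odd-indexed
terms vanish splits into a `p × p` and a `q × q` Hankel determinant of even-indexed terms. -/
theorem det_hankel_eq_mul_of_odd_eq_zero {R : Type*} [CommRing R] (c : ℕ → R)
    (hc : ∀ k : ℕ, c (2 * k + 1) = 0) {N p q : ℕ} (hN : N = p + q) (hqp : q ≤ p)
    (hpq : p ≤ q + 1) :
    Matrix.det (Matrix.of fun i j : Fin N => c ((i : ℕ) + (j : ℕ)))
      = Matrix.det (Matrix.of fun i j : Fin p => c (2 * ((i : ℕ) + (j : ℕ))))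
        * Matrix.det (Matrix.of fun i j : Fin q => c (2 * ((i : ℕ) + (j : ℕ)) + 2)) := by
  let f : Fin p ⊕ Fin q → Fin N :=
    Sum.elim (fun i => ⟨2 * i, by omega⟩) (fun i => ⟨2 * i + 1, by omega⟩)
  have hf : Function.Bijective f := by
    rw [Fintype.bijective_iff_injective_and_card]
    refine ⟨?_, by simp [hN]⟩
    rintro (i | i) (j | j) h <;> simp [f, Fin.ext_iff] at h ⊢ <;> omega
  rw [← Matrix.det_submatrix_equiv_self (Equiv.ofBijective f hf),
    ← Matrix.det_fromBlocks_zero₂₁ _ 0]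
  congr 1
  ext (i | i) (j | j)
  · simp [f, mul_add]
  · simpa [f, mul_add, add_assoc] using hc (i + j)
  · simpa [f, mul_add, add_right_comm] using hc (i + j)
  · simp only [Matrix.submatrix_apply, Equiv.ofBijective_apply, Matrix.of_apply, f, Sum.elim_inr,
      Matrix.fromBlocks_apply₂₂]
    congr 1
    ring

/-- Checkerboard factorization of Hankel determinants of a sequence whose
odd-indexed terms vanish (the moments of an even weight): the Hankel determinant of order
`2n` (resp. `2n + 1`) factorizes into the product of the Hankel determinants built from the
even moments `c_{2(i+j)}` and `c_{2(i+j)+2}`. -/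
theorem hankel_det_checkerboard_factorization
    (c : ℕ → ℝ) (hc : ∀ k : ℕ, c (2 * k + 1) = 0) :
    ∀ n : ℕ,
      (Matrix.det (Matrix.of fun i j : Fin (2 * n) => c ((i : ℕ) + (j : ℕ)))
        = Matrix.det (Matrix.of fun i j : Fin n => c (2 * ((i : ℕ) + (j : ℕ))))
          * Matrix.det (Matrix.of fun i j : Fin n => c (2 * ((i : ℕ) + (j : ℕ)) + 2))) ∧
      (Matrix.det (Matrix.of fun i j : Fin (2 * n + 1) => c ((i : ℕ) + (j : ℕ)))
        = Matrix.det (Matrix.of fun i j : Fin (n + 1) => c (2 * ((i : ℕ) + (j : ℕ))))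
          * Matrix.det (Matrix.of fun i j : Fin n => c (2 * ((i : ℕ) + (j : ℕ)) + 2))) := by
  intro n
  exact ⟨det_hankel_eq_mul_of_odd_eq_zero c hc (two_mul n) le_rfl n.le_succ,
    det_hankel_eq_mul_of_odd_eq_zero c hc (by omega) n.le_succ le_rfl⟩
end
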